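/- arXiv:0802.3035 — 6 statements merged into one kernel-verified Lean document; each statement's English description precedes it below -/
import Mathlib

section
/- Let r ≥ 1 and ℓ ≥ 1 be integers, put n = r+1 and q = ℓ+n. Let S ⊆ ℂⁿ be the set of all tuples (t₁,…,tₙ) such that t₁⋯tₙ = 1, the tᵢ are pairwise distinct, and tᵢ^q = tⱼ^q for all i,j. Then a symmetric polynomial f ∈ ℂ[x₁,…,xₙ] vanishes at every point of S if and only if f lies in the ideal of the ring of symmetric polynomials in x₁,…,xₙ generated by the complete homogeneous symmetric polynomials h_{ℓ+1}, h_{ℓ+2}, …, h_{ℓ+r} together with e_n − 1, where e_n = x₁⋯xₙ. (This is Gepner's presentation I_ℓ(sl_{r+1}) = ⟨χ_{(ℓ+1)ω₁},…,χ_{(ℓ+r)ω₁}⟩ of the fusion ideal, translated through the identifications χ_{kω₁} = h_k and R^ℂ(sl_n) = Sym/(e_n−1), the fusion ideal being the vanishing ideal of characters on the regular elements t of the diagonal torus of SL_n with (tᵢ/tⱼ)^{ℓ+n} = 1.) -/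
open MvPolynomial

section CompleteHomogeneous

variable {ι R : Type*} [DecidableEq ι] [CommRing R]

/-- The complete homogeneous symmetric polynomial of degree `k`, evaluated at the family `x`
restricted to the finite set `s`. -/
def completeHomogeneous (x : ι → R) (s : Finset ι) (k : ℕ) : R :=
  ∑ m ∈ s.sym k, (m.1.map x).prod

lemma completeHomogeneous_empty_succ (x : ι → R) (k : ℕ) :
    completeHomogeneous x ∅ (k + 1) = 0 := by
  simp [completeHomogeneous]

lemma completeHomogeneous_zero (x : ι → R) (s : Finset ι) :
    completeHomogeneous x s 0 = 1 := by
  simp only [completeHomogeneous, Finset.sym_zero, Finset.sum_singleton]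
  rfl

lemma map_completeHomogeneous {S : Type*} [CommRing S] (φ : R →+* S) (x : ι → R)
    (s : Finset ι) (k : ℕ) :
    φ (completeHomogeneous x s k) = completeHomogeneous (fun i => φ (x i)) s k := by
  simp [completeHomogeneous, map_sum, map_multiset_prod, Multiset.map_map]

lemma completeHomogeneous_X_univ [Fintype ι] (k : ℕ) :
    completeHomogeneous (X : ι → MvPolynomial ι R) Finset.univ k = hsymm ι R k := by
  simp [completeHomogeneous, hsymm]

lemma eval_hsymm [Fintype ι] (t : ι → R) (k : ℕ) :
    eval t (hsymm ι R k) = completeHomogeneous t Finset.univ k := by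
  rw [← completeHomogeneous_X_univ, map_completeHomogeneous]
  simp

lemma completeHomogeneous_insert_succ (x : ι → R) {s : Finset ι} {a : ι} (ha : a ∉ s) (k : ℕ) :
    completeHomogeneous x (insert a s) (k + 1) =
      completeHomogeneous x s (k + 1) + x a * completeHomogeneous x (insert a s) k := by
  have h : (insert a s).sym (k + 1) =
      s.sym (k + 1) ∪ ((insert a s).sym k).image (Sym.cons a) := by
    ext m
    simp only [Finset.mem_union, Finset.mem_image, Finset.mem_sym_iff]
    constructor
    · intro hm
      by_cases ham : a ∈ m
      · refine Or.inr ⟨m.erase a ham, fun b hb => hm b ?_, Sym.cons_erase ham⟩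
        rw [← Sym.cons_erase ham]
        exact Sym.mem_cons_of_mem hb
      · refine Or.inl fun b hb => (Finset.mem_insert.mp (hm b hb)).resolve_left ?_
        rintro rfl
        exact ham hb
    · rintro (hm | ⟨m, hm, rfl⟩) b hb
      · exact Finset.mem_insert_of_mem (hm b hb)
      · rcases Sym.mem_cons.mp hb with rfl | hb
        · exact Finset.mem_insert_self _ _
        · exact hm b hb
  have hd : Disjoint (s.sym (k + 1)) (((insert a s).sym k).image (Sym.cons a)) := by
    rw [Finset.disjoint_left]
    intro m hm hm'
    obtain ⟨m', -, rfl⟩ := Finset.mem_image.mp hm'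
    exact ha (Finset.mem_sym_iff.mp hm a (Sym.mem_cons_self a m'))
  rw [completeHomogeneous, h, Finset.sum_union hd,
    Finset.sum_image fun _ _ _ _ e => Sym.cons_inj_right a _ _ |>.mp e, completeHomogeneous,
    completeHomogeneous, Finset.mul_sum]
  congr 1
  refine Finset.sum_congr rfl fun m _ => ?_
  change (Multiset.map x (a ::ₘ m.1)).prod = _
  simp

lemma completeHomogeneous_singleton (x : ι → R) (a : ι) (k : ℕ) :
    completeHomogeneous x {a} k = x a ^ k := by
  induction k with
  | zero => simp [completeHomogeneous_zero]
  | succ k ih =>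
    have h := completeHomogeneous_insert_succ x (Finset.notMem_empty a) k
    rw [completeHomogeneous_empty_succ, insert_empty_eq, ih] at h
    rw [h]
    ring

lemma sub_mul_completeHomogeneous_insert_insert (x : ι → R) {s : Finset ι} {a b : ι}
    (ha : a ∉ s) (hb : b ∉ s) (hab : a ≠ b) (k : ℕ) :
    (x a - x b) * completeHomogeneous x (insert a (insert b s)) k =
      completeHomogeneous x (insert a s) (k + 1) -
        completeHomogeneous x (insert b s) (k + 1) := by
  have h₁ := completeHomogeneous_insert_succ x (s := insert b s) (a := a) (by simp [hab, ha]) k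
  have h₂ := completeHomogeneous_insert_succ x (s := insert a s) (a := b)
    (by simp [hab.symm, hb]) k
  rw [Finset.insert_comm b a] at h₂
  linear_combination h₂ - h₁

lemma completeHomogeneous_pair_of_eq (x : ι → R) {a b : ι} (hab : a ≠ b) (h : x a = x b) (k : ℕ) :
    completeHomogeneous x {a, b} k = (k + 1) * x a ^ k := by
  induction k with
  | zero => simp [completeHomogeneous_zero]
  | succ k ih =>
    rw [completeHomogeneous_insert_succ x (by simpa using hab), completeHomogeneous_singleton,
      ih, ← h]
    push_cast
    ring

lemma completeHomogeneous_pair_mem [Fintype ι] (I : Ideal R) (x : ι → R) {l q : ℕ}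
    (hq : q + 1 = l + Fintype.card ι)
    (h : ∀ k, l + 1 ≤ k → k ≤ q → completeHomogeneous x Finset.univ k ∈ I)
    {a b : ι} (hab : a ≠ b) : completeHomogeneous x {a, b} q ∈ I := by
  have key : ∀ (j : ℕ) (s : Finset ι), s.card + j = Fintype.card ι →
      ∀ k, l + 1 + j ≤ k → k ≤ q → completeHomogeneous x s k ∈ I := by
    intro j
    induction j with
    | zero =>
      intro s hs k h₁ h₂
      rw [(Finset.card_eq_iff_eq_univ s).mp (by omega)]
      exact h k h₁ h₂
    | succ j ih =>
      intro s hs k h₁ h₂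
      obtain ⟨c, hc⟩ : ∃ c, c ∉ s := by
        by_contra! hall
        have := (Finset.card_eq_iff_eq_univ s).mpr (Finset.eq_univ_iff_forall.mpr hall)
        omega
      obtain ⟨k, rfl⟩ : ∃ k', k = k' + 1 := ⟨k - 1, by omega⟩
      have hcard : (insert c s).card + j = Fintype.card ι := by
        rw [Finset.card_insert_of_notMem hc]
        omega
      rw [eq_sub_iff_add_eq.mpr (completeHomogeneous_insert_succ x hc k).symm]
      exact I.sub_mem (ih _ hcard _ (by omega) h₂)
        (I.mul_mem_left _ (ih _ hcard _ (by omega) (by omega)))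
  have hle : ({a, b} : Finset ι).card ≤ Fintype.card ι := Finset.card_le_univ _
  rw [Finset.card_pair hab] at hle
  exact key (Fintype.card ι - 2) _ (by rw [Finset.card_pair hab]; omega) q (by omega) le_rfl

lemma completeHomogeneous_eq_zero_of_pow_eq [IsDomain R] {x : ι → R}
    (hx : Function.Injective x) {q : ℕ} {c : R} (hc : ∀ i, x i ^ q = c) {s : Finset ι} {k : ℕ}
    (hk : q < k + s.card) (hkq : k < q) : completeHomogeneous x s k = 0 := by
  have key : ∀ (m : ℕ) (s : Finset ι), s.card = m + 1 →
      completeHomogeneous x s q = c ∧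
        ∀ k, q < k + s.card → k < q → completeHomogeneous x s k = 0 := by
    intro m
    induction m with
    | zero =>
      intro s hs
      obtain ⟨a, rfl⟩ := Finset.card_eq_one.mp hs
      exact ⟨by rw [completeHomogeneous_singleton, hc], fun k h₁ h₂ => by omega⟩
    | succ m ih =>
      intro s hs
      obtain ⟨a, u, hau, rfl, hu⟩ := Finset.card_eq_succ.mp hs
      obtain ⟨b, v, hbv, rfl, hv⟩ := Finset.card_eq_succ.mp hu
      have hab : a ≠ b := fun e => hau (by simp [e])
      have hav : a ∉ v := fun e => hau (Finset.mem_insert_of_mem e)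
      have hcard : (insert a v).card = m + 1 := by rw [Finset.card_insert_of_notMem hav, hv]
      have hzero : ∀ k, q < k + (insert a (insert b v)).card → k < q →
          completeHomogeneous x (insert a (insert b v)) k = 0 := by
        intro k h₁ h₂
        have h := sub_mul_completeHomogeneous_insert_insert x hav hbv hab k
        have hz : completeHomogeneous x (insert a v) (k + 1) =
            completeHomogeneous x (insert b v) (k + 1) := by
          rcases eq_or_ne (k + 1) q with rfl | hne
          · rw [(ih _ hcard).1, (ih _ hu).1]
          · rw [(ih _ hcard).2 _ (by omega) (by omega), (ih _ hu).2 _ (by omega) (by omega)]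
        rw [hz, sub_self] at h
        exact (mul_eq_zero.mp h).resolve_left (sub_ne_zero.mpr (hx.ne hab))
      refine ⟨?_, hzero⟩
      rcases q with _ | q
      · rw [completeHomogeneous_zero, ← hc a, pow_zero]
      · rw [completeHomogeneous_insert_succ x hau, (ih _ hu).1, hzero q (by omega) (by omega),
          mul_zero, add_zero]
  exact (key (s.card - 1) s (by omega)).2 k hk hkq

end CompleteHomogeneous

/-- An ideal of a polynomial ring over a field of characteristic zero modulo which every variable
is a root of unity is radical. -/
lemma MvPolynomial.isRadical_of_X_pow_sub_one_mem {σ K : Type*} [Finite σ] [Field K] [CharZero K]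
    (J : Ideal (MvPolynomial σ K)) {N : ℕ} (hN : N ≠ 0) (h : ∀ i, X i ^ N - 1 ∈ J) :
    J.IsRadical := by
  have hpow : ∀ i, (Ideal.Quotient.mk J (X i)) ^ N = 1 := fun i => by
    rw [← map_pow, ← map_one (Ideal.Quotient.mk J), Ideal.Quotient.eq]
    exact h i
  have hD : ∀ i,
      KaehlerDifferential.D K (MvPolynomial σ K ⧸ J) (Ideal.Quotient.mk J (X i)) = 0 := by
    intro i
    have h₁ := congrArg (KaehlerDifferential.D K (MvPolynomial σ K ⧸ J)) (hpow i)
    rw [Derivation.leibniz_pow, Derivation.map_one_eq_zero] at h₁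
    have hu : IsUnit (Ideal.Quotient.mk J (X i)) := IsUnit.of_pow_eq_one (hpow i) hN
    rw [← Nat.cast_smul_eq_nsmul K] at h₁
    have h₂ := (smul_eq_zero_iff_right (Nat.cast_ne_zero (R := K).mpr hN)).mp h₁
    exact (hu.pow (N - 1)).smul_eq_zero.mp h₂
  have hD' : KaehlerDifferential.D K (MvPolynomial σ K ⧸ J) = 0 := by
    have hadj : Algebra.adjoin K (Set.range fun i => Ideal.Quotient.mk J (X i)) = ⊤ := by
      have := congrArg (Subalgebra.map (Ideal.Quotient.mkₐ K J)) (adjoin_range_X (R := K) (σ := σ))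
      rw [AlgHom.map_adjoin, ← Set.range_comp, Algebra.map_top,
        (AlgHom.range_eq_top _).mpr (Ideal.Quotient.mkₐ_surjective K J)] at this
      exact this
    refine Derivation.ext_of_adjoin_eq_top _ hadj ?_
    rintro _ ⟨i, rfl⟩
    exact hD i
  have : Algebra.FormallyUnramified K (MvPolynomial σ K ⧸ J) := by
    refine ⟨?_⟩
    rw [← Submodule.subsingleton_iff (MvPolynomial σ K ⧸ J), ← subsingleton_iff_bot_eq_top,
      ← KaehlerDifferential.span_range_derivation, eq_comm, Submodule.span_eq_bot, hD']
    rintro _ ⟨y, rfl⟩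
    rfl
  rw [Ideal.isRadical_iff_quotient_reduced]
  exact Algebra.FormallyUnramified.isReduced_of_field K _

/-- In characteristic zero, extending an ideal of symmetric polynomials to the polynomial ring and
contracting it back gives the same ideal. -/
lemma MvPolynomial.mem_span_of_coe_mem_span {σ K : Type*} [Fintype σ] [Field K] [CharZero K]
    (G : Set (symmetricSubalgebra σ K)) (f : symmetricSubalgebra σ K)
    (hf : (f : MvPolynomial σ K) ∈ Ideal.span ((↑) '' G : Set (MvPolynomial σ K))) :
    f ∈ Ideal.span G := by
  classical
  have hsymm : ∀ p : MvPolynomial σ K,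
      (∑ e : Equiv.Perm σ, rename e p) ∈ symmetricSubalgebra σ K := by
    intro p
    rw [mem_symmetricSubalgebra]
    intro e
    rw [map_sum]
    simp only [rename_rename, ← Equiv.Perm.coe_mul]
    exact Fintype.sum_equiv (Equiv.mulLeft e) _ _ fun _ => rfl
  have hmul : ∀ (p : MvPolynomial σ K) (g : symmetricSubalgebra σ K),
      ∑ e : Equiv.Perm σ, rename e (p * (g : MvPolynomial σ K)) =
        (∑ e : Equiv.Perm σ, rename e p) * (g : MvPolynomial σ K) := by
    intro p g
    rw [Finset.sum_mul]
    refine Finset.sum_congr rfl fun e _ => ?_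
    rw [map_mul, (mem_symmetricSubalgebra _).mp g.2 e]
  have key : ∀ p ∈ Ideal.span ((↑) '' G : Set (MvPolynomial σ K)), ∀ a : MvPolynomial σ K,
      (⟨_, hsymm (a * p)⟩ : symmetricSubalgebra σ K) ∈ Ideal.span G := by
    intro p hp
    induction hp using Submodule.span_induction with
    | mem p hp =>
      intro a
      obtain ⟨g, hg, rfl⟩ := hp
      convert (Ideal.span G).mul_mem_left ⟨_, hsymm a⟩ (Ideal.subset_span hg) using 1
      ext1
      exact hmul a g
    | zero =>
      intro a
      convert (Ideal.span G).zero_mem using 1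
      ext1
      simp
    | add p p' _ _ ih ih' =>
      intro a
      convert (Ideal.span G).add_mem (ih a) (ih' a) using 1
      ext1
      simp [mul_add, Finset.sum_add_distrib]
    | smul b p _ ih =>
      intro a
      convert ih (a * b) using 1
      ext1
      simp only [smul_eq_mul, mul_assoc]
  have hcard : (Fintype.card (Equiv.Perm σ) : K) ≠ 0 := Nat.cast_ne_zero.mpr Fintype.card_ne_zero
  convert Submodule.smul_of_tower_mem (Ideal.span G) (Fintype.card (Equiv.Perm σ) : K)⁻¹
    (key f hf 1) using 1
  ext1
  have hsum : ∑ e : Equiv.Perm σ, rename e (1 * (f : MvPolynomial σ K)) =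
      (Fintype.card (Equiv.Perm σ) : K) • (f : MvPolynomial σ K) := by
    rw [hmul]
    simp [Nat.cast_smul_eq_nsmul]
  exact (eq_inv_smul_iff₀ hcard).mpr hsum.symm

lemma MvPolynomial.esymm_card_eq_prod (n : ℕ) (R : Type*) [CommSemiring R] :
    esymm (Fin n) R n = ∏ i, X i := by
  have h := Finset.powersetCard_self (Finset.univ : Finset (Fin n))
  rw [Finset.card_fin] at h
  rw [esymm, h, Finset.sum_singleton]

/-- **Gepner's presentation of the fusion ideal for `sl_{r+1}`.**
Let `n = r+1`, `q = ℓ+n`.  A symmetric polynomial `f ∈ ℂ[x₁,…,xₙ]` vanishes at every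
point `t` of the set `S` (tuples with product `1`, pairwise distinct entries, and all
`q`-th powers equal) if and only if, viewed as an element of the ring of symmetric
polynomials, it lies in the ideal generated by the complete homogeneous symmetric
polynomials `h_{ℓ+1}, …, h_{ℓ+r}` together with `eₙ − 1`. -/
theorem stmt_0 (r ℓ : ℕ) (hr : 1 ≤ r) (hℓ : 1 ≤ ℓ)
    (n q : ℕ) (hn : n = r + 1) (hq : q = ℓ + n)
    (f : MvPolynomial (Fin n) ℂ) (hf : f.IsSymmetric) :
    (∀ t : Fin n → ℂ, (∏ i, t i = 1) → Function.Injective t →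
        (∀ i j, t i ^ q = t j ^ q) → eval t f = 0) ↔
      (⟨f, (mem_symmetricSubalgebra f).mpr hf⟩ : symmetricSubalgebra (Fin n) ℂ) ∈
        Ideal.span {x : symmetricSubalgebra (Fin n) ℂ |
          (∃ k, ℓ + 1 ≤ k ∧ k ≤ ℓ + r ∧ (x : MvPolynomial (Fin n) ℂ) = hsymm (Fin n) ℂ k) ∨
          (x : MvPolynomial (Fin n) ℂ) = esymm (Fin n) ℂ n - 1} := by
  set G := {x : symmetricSubalgebra (Fin n) ℂ |
    (∃ k, ℓ + 1 ≤ k ∧ k ≤ ℓ + r ∧ (x : MvPolynomial (Fin n) ℂ) = hsymm (Fin n) ℂ k) ∨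
    (x : MvPolynomial (Fin n) ℂ) = esymm (Fin n) ℂ n - 1}
  constructor
  · intro h
    apply mem_span_of_coe_mem_span
    set J := Ideal.span ((↑) '' G : Set (MvPolynomial (Fin n) ℂ))
    change f ∈ J
    have hprod : (∏ i, X i : MvPolynomial (Fin n) ℂ) - 1 ∈ J := by
      rw [← esymm_card_eq_prod]
      exact Ideal.subset_span
        ⟨⟨_, (symmetricSubalgebra (Fin n) ℂ).sub_mem (esymm_isSymmetric (Fin n) ℂ n)
          (symmetricSubalgebra (Fin n) ℂ).one_mem⟩, Or.inr rfl, rfl⟩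
    have hpair : ∀ i j : Fin n, i ≠ j → completeHomogeneous X {i, j} (ℓ + r) ∈ J := by
      intro i j hij
      refine completeHomogeneous_pair_mem J X (l := ℓ) (by simp [hn]; ring) ?_ hij
      intro k h₁ h₂
      rw [completeHomogeneous_X_univ]
      exact Ideal.subset_span ⟨⟨_, hsymm_isSymmetric (Fin n) ℂ k⟩, Or.inl ⟨k, h₁, h₂, rfl⟩, rfl⟩
    have hpow : ∀ i j : Fin n, (X i ^ q - X j ^ q : MvPolynomial (Fin n) ℂ) ∈ J := by
      intro i j
      rcases eq_or_ne i j with rfl | hij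
      · simp
      have hd := sub_mul_completeHomogeneous_insert_insert (X : Fin n → MvPolynomial (Fin n) ℂ)
        (Finset.notMem_empty i) (Finset.notMem_empty j) hij (ℓ + r)
      simp only [insert_empty_eq, completeHomogeneous_singleton] at hd
      rw [show q = ℓ + r + 1 by omega, ← hd]
      exact J.mul_mem_left _ (hpair i j hij)
    have hroot : ∀ i : Fin n, (X i ^ (q * n) - 1 : MvPolynomial (Fin n) ℂ) ∈ J := by
      intro i
      rw [← Ideal.Quotient.eq, map_one, pow_mul, map_pow]
      rw [← Ideal.Quotient.eq, map_one, map_prod] at hprod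
      calc Ideal.Quotient.mk J (X i ^ q) ^ n
          = ∏ j : Fin n, Ideal.Quotient.mk J (X j ^ q) := by
            rw [Finset.prod_congr rfl fun j _ => (Ideal.Quotient.eq.mpr (hpow j i))]
            simp
        _ = 1 := by simp only [map_pow, Finset.prod_pow, hprod, one_pow]
    have hrad : J.IsRadical :=
      isRadical_of_X_pow_sub_one_mem J (N := q * n)
        (Nat.mul_ne_zero (by omega) (by omega)) hroot
    rw [← hrad.radical, ← vanishingIdeal_zeroLocus_eq_radical (K := ℂ)]
    intro t ht
    have hev : ∀ p ∈ J, eval t p = 0 := fun p hp => by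
      simpa [aeval_eq_eval] using ht p hp
    have htprod : ∏ i, t i = 1 := by
      simpa [sub_eq_zero] using hev _ hprod
    rw [aeval_eq_eval]
    refine h t htprod ?_ fun i j => by simpa [sub_eq_zero] using hev _ (hpow i j)
    intro i j hij
    by_contra hne
    have hz := hev _ (hpair i j hne)
    rw [map_completeHomogeneous] at hz
    simp only [eval_X] at hz
    rw [completeHomogeneous_pair_of_eq t hne hij] at hz
    have hti : t i ≠ 0 := fun h0 => by
      rw [Finset.prod_eq_zero (Finset.mem_univ i) h0] at htprod
      exact zero_ne_one htprod
    exact mul_ne_zero (Nat.cast_add_one_ne_zero _) (pow_ne_zero _ hti) hz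
  · intro hmem t htprod htinj htpow
    have hle : Ideal.span G ≤ RingHom.ker
        ((eval t).comp (symmetricSubalgebra (Fin n) ℂ).val.toRingHom) := by
      rw [Ideal.span_le]
      rintro x (⟨k, h₁, h₂, hx⟩ | hx)
      · change eval t (x : MvPolynomial (Fin n) ℂ) = 0
        rw [hx, eval_hsymm]
        exact completeHomogeneous_eq_zero_of_pow_eq htinj (fun i => htpow i ⟨0, by omega⟩)
          (by rw [Finset.card_fin]; omega) (by omega)
      · change eval t (x : MvPolynomial (Fin n) ℂ) = 0
        rw [hx, esymm_card_eq_prod]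
        simp [htprod]
    exact hle hmem
end

section
/- Let ℓ ≥ 1 be an integer and let C be the Cartan matrix of type E₆ (Bourbaki numbering). Define the symmetric bilinear form B on ℚ⁶ (coordinates with respect to the simple roots α₁,…,α₆, so α_i is the i-th standard basis vector) by B(α_i, α_j) = C_{ij}. Call v ∈ ℤ⁶ a root if B(v,v) = 2, and a positive root if moreover all its coordinates are ≥ 0. Let ρ ∈ ℚ⁶ be the unique vector with B(ρ, α_i) = 1 for all i, and ω₁ the unique vector with B(ω₁, α_i) = δ_{1i}. Then for every integer m with 1 ≤ m ≤ 11 there exists a positive root μ such that B((ℓ+m)ω₁ + ρ, μ) = ℓ + 12. In particular, (ℓ+m)ω₁ + ρ lies on an affine wall of E₆ at level ℓ, the dual Coxeter number of E₆ being ȟ = 12. -/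
/-- The Cartan matrix of `E₆` (Bourbaki numbering: node 2 attached to node 4 of the
chain 1–3–4–5–6). -/
def cartanE6 : Matrix (Fin 6) (Fin 6) ℚ :=
  !![2, 0, -1, 0, 0, 0;
     0, 2, 0, -1, 0, 0;
     -1, 0, 2, -1, 0, 0;
     0, -1, -1, 2, -1, 0;
     0, 0, 0, -1, 2, -1;
     0, 0, 0, 0, -1, 2]

/-- The normalized Killing form of `E₆` in simple-root coordinates: its Gram matrix is the
Cartan matrix. -/
def BE6 (x y : Fin 6 → ℚ) : ℚ := ∑ i, ∑ j, x i * cartanE6 i j * y j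

/-- The `i`-th simple root `α_i` of `E₆` in simple-root coordinates (0-indexed). -/
def sbE6 (i : Fin 6) : Fin 6 → ℚ := fun j => if j = i then 1 else 0

/-- `BE6 x` is linear in its second argument, expanded along the simple roots. -/
theorem BE6_eq_sum_simpleRoots (x y : Fin 6 → ℚ) : BE6 x y = ∑ i, y i * BE6 x (sbE6 i) := by
  simp only [BE6, sbE6, mul_ite, mul_one, mul_zero, Finset.sum_ite_eq', Finset.mem_univ, if_true,
    Finset.mul_sum]
  rw [Finset.sum_comm]
  exact Finset.sum_congr rfl fun j _ => Finset.sum_congr rfl fun i _ => mul_comm _ _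

theorem BE6_smul_add_left (c : ℚ) (x y z : Fin 6 → ℚ) :
    BE6 (c • x + y) z = c * BE6 x z + BE6 y z := by
  simp only [BE6, Pi.add_apply, Pi.smul_apply, smul_eq_mul, Finset.mul_sum,
    ← Finset.sum_add_distrib]
  exact Finset.sum_congr rfl fun i _ => Finset.sum_congr rfl fun j _ => by ring

/-- `E₆` has a positive root of each height from `1` to `11` whose `α₁`-coefficient is `1`. -/
theorem exists_posRoot_of_height (h : ℕ) (h_pos : 1 ≤ h) (h_le : h ≤ 11) :
    ∃ μ : Fin 6 → ℤ, BE6 (fun i => (μ i : ℚ)) (fun i => (μ i : ℚ)) = 2 ∧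
      (∀ i, 0 ≤ μ i) ∧ μ 0 = 1 ∧ ∑ i, μ i = h := by
  interval_cases h
  · exact ⟨![1, 0, 0, 0, 0, 0], by norm_num [BE6, cartanE6, Fin.sum_univ_succ], by decide, rfl, rfl⟩
  · exact ⟨![1, 0, 1, 0, 0, 0], by norm_num [BE6, cartanE6, Fin.sum_univ_succ], by decide, rfl, rfl⟩
  · exact ⟨![1, 0, 1, 1, 0, 0], by norm_num [BE6, cartanE6, Fin.sum_univ_succ], by decide, rfl, rfl⟩
  · exact ⟨![1, 1, 1, 1, 0, 0], by norm_num [BE6, cartanE6, Fin.sum_univ_succ], by decide, rfl, rfl⟩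
  · exact ⟨![1, 1, 1, 1, 1, 0], by norm_num [BE6, cartanE6, Fin.sum_univ_succ], by decide, rfl, rfl⟩
  · exact ⟨![1, 1, 1, 1, 1, 1], by norm_num [BE6, cartanE6, Fin.sum_univ_succ], by decide, rfl, rfl⟩
  · exact ⟨![1, 1, 1, 2, 1, 1], by norm_num [BE6, cartanE6, Fin.sum_univ_succ], by decide, rfl, rfl⟩
  · exact ⟨![1, 1, 2, 2, 1, 1], by norm_num [BE6, cartanE6, Fin.sum_univ_succ], by decide, rfl, rfl⟩
  · exact ⟨![1, 1, 2, 2, 2, 1], by norm_num [BE6, cartanE6, Fin.sum_univ_succ], by decide, rfl, rfl⟩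
  · exact ⟨![1, 1, 2, 3, 2, 1], by norm_num [BE6, cartanE6, Fin.sum_univ_succ], by decide, rfl, rfl⟩
  · exact ⟨![1, 2, 2, 3, 2, 1], by norm_num [BE6, cartanE6, Fin.sum_univ_succ], by decide, rfl, rfl⟩

/-- **(E₆ walls).**  With `B` the bilinear form given by the Cartan matrix of `E₆`,
`ρ` the unique vector with `B(ρ, αᵢ) = 1` for all `i`, and `ω₁` the unique vector with
`B(ω₁, αᵢ) = δ_{1i}`: for every `1 ≤ m ≤ 11` there is a positive root `μ` (an integral
vector with `B(μ,μ) = 2` and nonnegative coordinates) such that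
`B((ℓ+m)ω₁ + ρ, μ) = ℓ + 12`.  In particular `(ℓ+m)ω₁ + ρ` lies on an affine wall of `E₆`
at level `ℓ` (the dual Coxeter number being `ȟ = 12`). -/
theorem stmt_10 (ℓ : ℕ) (hℓ : 1 ≤ ℓ)
    (ρ : Fin 6 → ℚ) (hρ : ∀ i, BE6 ρ (sbE6 i) = 1)
    (ω₁ : Fin 6 → ℚ) (hω : ∀ i, BE6 ω₁ (sbE6 i) = if i = 0 then 1 else 0) :
    ∀ m : ℕ, 1 ≤ m → m ≤ 11 →
      ∃ μ : Fin 6 → ℤ,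
        BE6 (fun i => (μ i : ℚ)) (fun i => (μ i : ℚ)) = 2 ∧
        (∀ i, 0 ≤ μ i) ∧
        BE6 (((ℓ : ℚ) + m) • ω₁ + ρ) (fun i => (μ i : ℚ)) = (ℓ : ℚ) + 12 := by
  intro m hm hm'
  obtain ⟨μ, hroot, hpos, h_one, hsum⟩ := exists_posRoot_of_height (12 - m) (by omega) (by omega)
  refine ⟨μ, hroot, hpos, ?_⟩
  have hω' : BE6 ω₁ (fun i => (μ i : ℚ)) = 1 := by
    rw [BE6_eq_sum_simpleRoots]
    simp [hω, h_one]
  have hρ' : BE6 ρ (fun i => (μ i : ℚ)) = 12 - m := by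
    rw [BE6_eq_sum_simpleRoots]
    simp only [hρ, mul_one]
    rw [← Int.cast_sum, hsum, Int.cast_natCast, Nat.cast_sub (by omega)]
    norm_num
  rw [BE6_smul_add_left, hω', hρ']
  ring
end

section
/- Let ℓ ≥ 1 be an integer and let C be the Cartan matrix of type E₇ (Bourbaki numbering). Define the symmetric bilinear form B on ℚ⁷ (coordinates with respect to the simple roots α₁,…,α₇) by B(α_i, α_j) = C_{ij}. Call v ∈ ℤ⁷ a root if B(v,v) = 2, and a positive root if moreover all its coordinates are ≥ 0. Let ρ ∈ ℚ⁷ be the unique vector with B(ρ, α_i) = 1 for all i, and ω₇ the unique vector with B(ω₇, α_i) = δ_{7i}. Then for every integer m with 1 ≤ m ≤ 17 there exists a positive root μ such that B((ℓ+m)ω₇ + ρ, μ) = ℓ + 18. In particular, (ℓ+m)ω₇ + ρ lies on an affine wall of E₇ at level ℓ, the dual Coxeter number of E₇ being ȟ = 18. -/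
/-- The Cartan matrix of `E₇` (Bourbaki numbering: node 2 attached to node 4 of the
chain 1–3–4–5–6–7). -/
def cartanE7 : Matrix (Fin 7) (Fin 7) ℚ :=
  !![2, 0, -1, 0, 0, 0, 0;
     0, 2, 0, -1, 0, 0, 0;
     -1, 0, 2, -1, 0, 0, 0;
     0, -1, -1, 2, -1, 0, 0;
     0, 0, 0, -1, 2, -1, 0;
     0, 0, 0, 0, -1, 2, -1;
     0, 0, 0, 0, 0, -1, 2]

/-- The normalized Killing form of `E₇` in simple-root coordinates: its Gram matrix is the
Cartan matrix. -/
def BE7 (x y : Fin 7 → ℚ) : ℚ := ∑ i, ∑ j, x i * cartanE7 i j * y j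

/-- The `i`-th simple root `α_i` of `E₇` in simple-root coordinates (0-indexed). -/
def sbE7 (i : Fin 7) : Fin 7 → ℚ := fun j => if j = i then 1 else 0

theorem BE7_eq_sum_mul_sbE7 (x y : Fin 7 → ℚ) : BE7 x y = ∑ j, y j * BE7 x (sbE7 j) := by
  simp only [BE7, sbE7, mul_ite, mul_one, mul_zero, Finset.sum_ite_eq',
    Finset.mem_univ, if_true, Finset.mul_sum]
  rw [Finset.sum_comm]
  exact Finset.sum_congr rfl fun j _ => Finset.sum_congr rfl fun i _ => by ring

theorem BE7_smul_add (a : ℚ) (x y z : Fin 7 → ℚ) :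
    BE7 (a • x + y) z = a * BE7 x z + BE7 y z := by
  simp only [BE7, Finset.mul_sum, ← Finset.sum_add_distrib, Pi.add_apply, Pi.smul_apply,
    smul_eq_mul]
  exact Finset.sum_congr rfl fun i _ => Finset.sum_congr rfl fun j _ => by ring

/-- A saturated chain of positive roots of `E₇` from the highest root down to `α₇`, each with
`α₇`-coefficient `1`; the `k`-th entry has height `17 - k`. -/
def rootChainE7 : Fin 17 → Fin 7 → ℤ :=
  ![![2, 2, 3, 4, 3, 2, 1],
    ![1, 2, 3, 4, 3, 2, 1],
    ![1, 2, 2, 4, 3, 2, 1],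
    ![1, 2, 2, 3, 3, 2, 1],
    ![1, 2, 2, 3, 2, 2, 1],
    ![1, 1, 2, 3, 2, 2, 1],
    ![1, 1, 2, 2, 2, 2, 1],
    ![1, 1, 1, 2, 2, 2, 1],
    ![1, 1, 1, 2, 2, 1, 1],
    ![1, 1, 1, 2, 1, 1, 1],
    ![1, 1, 1, 1, 1, 1, 1],
    ![0, 1, 1, 1, 1, 1, 1],
    ![0, 1, 0, 1, 1, 1, 1],
    ![0, 0, 0, 1, 1, 1, 1],
    ![0, 0, 0, 0, 1, 1, 1],
    ![0, 0, 0, 0, 0, 1, 1],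
    ![0, 0, 0, 0, 0, 0, 1]]

theorem rootChainE7_nonneg : ∀ k i, 0 ≤ rootChainE7 k i := by decide

theorem rootChainE7_apply_six : ∀ k, rootChainE7 k 6 = 1 := by decide

theorem sum_rootChainE7 : ∀ k : Fin 17, ∑ i, rootChainE7 k i = 17 - (k : ℕ) := by decide

theorem BE7_rootChainE7_self (k : Fin 17) :
    BE7 (fun i => (rootChainE7 k i : ℚ)) (fun i => (rootChainE7 k i : ℚ)) = 2 := by
  fin_cases k <;> norm_num [BE7, cartanE7, rootChainE7, Fin.sum_univ_succ]

/-- **(E₇ walls).**  With `B` the bilinear form given by the Cartan matrix of `E₇`,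
`ρ` the unique vector with `B(ρ, αᵢ) = 1` for all `i`, and `ω₇` the unique vector with
`B(ω₇, αᵢ) = δ_{7i}`: for every `1 ≤ m ≤ 17` there is a positive root `μ` (an integral
vector with `B(μ,μ) = 2` and nonnegative coordinates) such that
`B((ℓ+m)ω₇ + ρ, μ) = ℓ + 18`.  In particular `(ℓ+m)ω₇ + ρ` lies on an affine wall of `E₇`
at level `ℓ` (the dual Coxeter number being `ȟ = 18`). -/
theorem stmt_11 (ℓ : ℕ) (hℓ : 1 ≤ ℓ)
    (ρ : Fin 7 → ℚ) (hρ : ∀ i, BE7 ρ (sbE7 i) = 1)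
    (ω₇ : Fin 7 → ℚ) (hω : ∀ i, BE7 ω₇ (sbE7 i) = if i = 6 then 1 else 0) :
    ∀ m : ℕ, 1 ≤ m → m ≤ 17 →
      ∃ μ : Fin 7 → ℤ,
        BE7 (fun i => (μ i : ℚ)) (fun i => (μ i : ℚ)) = 2 ∧
        (∀ i, 0 ≤ μ i) ∧
        BE7 (((ℓ : ℚ) + m) • ω₇ + ρ) (fun i => (μ i : ℚ)) = (ℓ : ℚ) + 18 := by
  intro m hm hm'
  obtain ⟨k, rfl⟩ := Nat.exists_eq_add_of_le' hm
  have hk : k < 17 := by lia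
  refine ⟨rootChainE7 ⟨k, hk⟩, BE7_rootChainE7_self _, rootChainE7_nonneg _, ?_⟩
  have hsum : ∑ i, (rootChainE7 ⟨k, hk⟩ i : ℚ) = 17 - k := by
    exact_mod_cast sum_rootChainE7 ⟨k, hk⟩
  rw [BE7_smul_add, BE7_eq_sum_mul_sbE7 ω₇, BE7_eq_sum_mul_sbE7 ρ]
  simp only [hρ, hω, mul_ite, mul_one, mul_zero, Finset.sum_ite_eq', Finset.mem_univ, if_true,
    hsum, rootChainE7_apply_six]
  push_cast
  ring
end

section
/- Let ℓ ≥ 1 be an integer and let C be the Cartan matrix of type E₈ (Bourbaki numbering). Define the symmetric bilinear form B on ℚ⁸ (coordinates with respect to the simple roots α₁,…,α₈) by B(α_i, α_j) = C_{ij}. Call v ∈ ℤ⁸ a root if B(v,v) = 2, and a positive root if moreover all its coordinates are ≥ 0. Let ρ ∈ ℚ⁸ be the unique vector with B(ρ, α_i) = 1 for all i, and ω₈ the unique vector with B(ω₈, α_i) = δ_{8i}. Then for every integer m with 2 ≤ m ≤ 29 there exists a positive root μ such that B((ℓ+m)ω₈ + ρ, μ) = ℓ + 30. In particular, (ℓ+m)ω₈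 + ρ lies on an affine wall of E₈ at level ℓ, the dual Coxeter number of E₈ being ȟ = 30. -/
/-- The Cartan matrix of `E₈` (Bourbaki numbering: node 2 attached to node 4 of the
chain 1–3–4–5–6–7–8). -/
def cartanE8 : Matrix (Fin 8) (Fin 8) ℚ :=
  !![2, 0, -1, 0, 0, 0, 0, 0;
     0, 2, 0, -1, 0, 0, 0, 0;
     -1, 0, 2, -1, 0, 0, 0, 0;
     0, -1, -1, 2, -1, 0, 0, 0;
     0, 0, 0, -1, 2, -1, 0, 0;
     0, 0, 0, 0, -1, 2, -1, 0;
     0, 0, 0, 0, 0, -1, 2, -1;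
     0, 0, 0, 0, 0, 0, -1, 2]

/-- The normalized Killing form of `E₈` in simple-root coordinates: its Gram matrix is the
Cartan matrix. -/
def BE8 (x y : Fin 8 → ℚ) : ℚ := ∑ i, ∑ j, x i * cartanE8 i j * y j

/-- The `i`-th simple root `α_i` of `E₈` in simple-root coordinates (0-indexed). -/
def sbE8 (i : Fin 8) : Fin 8 → ℚ := fun j => if j = i then 1 else 0

/-- Adding the simple roots of this word one at a time climbs through roots of `E₈`,
from `α₈` up to the highest root in which `α₈` has coefficient `1`. -/
def climbE8 : List (Fin 8) :=
  [7, 6, 5, 4, 3, 1, 2, 0, 3, 2, 4, 3, 1, 5, 4, 3, 2, 0, 6, 5, 4, 3, 1, 2, 3, 4, 5, 6]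

/-- The root of height `h` on the chain `climbE8`, for `1 ≤ h ≤ 28`. -/
def chainE8 (h : ℕ) (i : Fin 8) : ℤ := (climbE8.take h).count i

theorem BE8_add_left (x y z : Fin 8 → ℚ) : BE8 (x + y) z = BE8 x z + BE8 y z := by
  simp only [BE8, Pi.add_apply, add_mul, Finset.sum_add_distrib]

theorem BE8_smul_left (c : ℚ) (x z : Fin 8 → ℚ) : BE8 (c • x) z = c * BE8 x z := by
  simp only [BE8, Pi.smul_apply, smul_eq_mul, mul_assoc, Finset.mul_sum]

theorem BE8_sbE8_right (x : Fin 8 → ℚ) (j : Fin 8) :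
    BE8 x (sbE8 j) = ∑ i, x i * cartanE8 i j := by
  simp [BE8, sbE8]

theorem BE8_eq_sum_sbE8 (x y : Fin 8 → ℚ) : BE8 x y = ∑ j, y j * BE8 x (sbE8 j) := by
  simp only [BE8_sbE8_right, Finset.mul_sum]
  rw [BE8, Finset.sum_comm]
  exact Finset.sum_congr rfl fun j _ => Finset.sum_congr rfl fun i _ => by ring

theorem chainE8_eight {h : ℕ} (h₁ : 1 ≤ h) (h₂ : h ≤ 28) : chainE8 h 7 = 1 := by
  interval_cases h <;> decide

theorem sum_chainE8 {h : ℕ} (h₂ : h ≤ 28) : ∑ i, chainE8 h i = h := by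
  interval_cases h <;> decide

theorem BE8_chainE8_self {h : ℕ} (h₁ : 1 ≤ h) (h₂ : h ≤ 28) :
    BE8 (fun i => (chainE8 h i : ℚ)) (fun i => (chainE8 h i : ℚ)) = 2 := by
  interval_cases h <;> decide +kernel

/-- **(E₈ walls).**  With `B` the bilinear form given by the Cartan matrix of `E₈`,
`ρ` the unique vector with `B(ρ, αᵢ) = 1` for all `i`, and `ω₈` the unique vector with
`B(ω₈, αᵢ) = δ_{8i}`: for every `2 ≤ m ≤ 29` there is a positive root `μ` (an integral
vector with `B(μ,μ) = 2` and nonnegative coordinates) such that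
`B((ℓ+m)ω₈ + ρ, μ) = ℓ + 30`.  In particular `(ℓ+m)ω₈ + ρ` lies on an affine wall of `E₈`
at level `ℓ` (the dual Coxeter number being `ȟ = 30`). -/
theorem stmt_12 (ℓ : ℕ) (hℓ : 1 ≤ ℓ)
    (ρ : Fin 8 → ℚ) (hρ : ∀ i, BE8 ρ (sbE8 i) = 1)
    (ω₈ : Fin 8 → ℚ) (hω : ∀ i, BE8 ω₈ (sbE8 i) = if i = 7 then 1 else 0) :
    ∀ m : ℕ, 2 ≤ m → m ≤ 29 →
      ∃ μ : Fin 8 → ℤ,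
        BE8 (fun i => (μ i : ℚ)) (fun i => (μ i : ℚ)) = 2 ∧
        (∀ i, 0 ≤ μ i) ∧
        BE8 (((ℓ : ℚ) + m) • ω₈ + ρ) (fun i => (μ i : ℚ)) = (ℓ : ℚ) + 30 := by
  intro m hm₁ hm₂
  have h₁ : 1 ≤ 30 - m := by omega
  have h₂ : 30 - m ≤ 28 := by omega
  refine ⟨chainE8 (30 - m), BE8_chainE8_self h₁ h₂, fun i => Int.natCast_nonneg _, ?_⟩
  have hω' : BE8 ω₈ (fun i => (chainE8 (30 - m) i : ℚ)) = 1 := by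
    rw [BE8_eq_sum_sbE8]
    simp [hω, chainE8_eight h₁ h₂]
  have hρ' : BE8 ρ (fun i => (chainE8 (30 - m) i : ℚ)) = 30 - m := by
    rw [BE8_eq_sum_sbE8]
    simp only [hρ, mul_one]
    rw [← Int.cast_sum, sum_chainE8 h₂, Int.cast_natCast, Nat.cast_sub (by omega)]
    norm_num
  rw [BE8_add_left, BE8_smul_left, hω', hρ']
  ring
end

section
/- Let r ≥ 3 and ℓ ≥ 1 be integers. In ℝ^r with the standard inner product ⟨·,·⟩, with B_r data ω₁ = e₁ and ρ = Σ_{i=1}^r (r − i + 1/2) e_i, the following holds: for every integer m with 1 ≤ m ≤ 2r−2 there exists a root μ of B_r (i.e. μ ∈ {±e_i ± e_j : i < j} ∪ {±e_i}) such that ⟨(ℓ+m)ω₁ + ρ, μ⟩ = ℓ + 2r − 1. That is, each of the vectors (ℓ+1)ω₁ + ρ, (ℓ+2)ω₁ + ρ, …, (ℓ+2r−2)ω₁ + ρ lies on an affine wall H_{μ,1} of B_r at level ℓ. -/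
open Finset

/-- `stdE r i` is the standard basis vector `e_{i+1}` (0-indexed `i`) of `ℝ^r`. -/
noncomputable def stdE (r : ℕ) (i : Fin r) : Fin r → ℝ := fun j => if j = i then 1 else 0

/-- The standard inner product on `ℝ^r`. -/
noncomputable def ip {r : ℕ} (x y : Fin r → ℝ) : ℝ := ∑ j, x j * y j

/-- `v` is a root of `B_r`: one of `±eᵢ ± eⱼ` (`i < j`) or `±eᵢ`. -/
def isRootBr {r : ℕ} (v : Fin r → ℝ) : Prop :=
  (∃ i j : Fin r, i < j ∧ (v = stdE r i + stdE r j ∨ v = stdE r i - stdE r j ∨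
    v = -stdE r i + stdE r j ∨ v = -stdE r i - stdE r j)) ∨
  (∃ i : Fin r, v = stdE r i ∨ v = -stdE r i)

theorem ip_add_right {r : ℕ} (x y z : Fin r → ℝ) : ip x (y + z) = ip x y + ip x z := by
  simp [ip, mul_add, Finset.sum_add_distrib]

theorem ip_sub_right {r : ℕ} (x y z : Fin r → ℝ) : ip x (y - z) = ip x y - ip x z := by
  simp [ip, mul_sub, Finset.sum_sub_distrib]

theorem ip_stdE {r : ℕ} (x : Fin r → ℝ) (i : Fin r) : ip x (stdE r i) = x i := by
  simp [ip, stdE]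

/-- **(All B_r walls).**  With the `B_r` data `ω₁ = e₁` and `ρ = Σᵢ (r − i + 1/2) eᵢ`,
for every `1 ≤ m ≤ 2r−2` there exists a root `μ` of `B_r` such that
`⟨(ℓ+m)ω₁ + ρ, μ⟩ = ℓ + 2r − 1`; i.e. each vector `(ℓ+m)ω₁ + ρ`, `1 ≤ m ≤ 2r−2 = ȟ−1`,
lies on an affine wall `H_{μ,1}` of `B_r` at level `ℓ`. -/
theorem stmt_14 (r ℓ : ℕ) (hr : 3 ≤ r) (hℓ : 1 ≤ ℓ)
    (ω₁ : Fin r → ℝ) (hω : ω₁ = stdE r ⟨0, by omega⟩)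
    (ρ : Fin r → ℝ) (hρ : ρ = fun i : Fin r => (r : ℝ) - ((i : ℕ) + 1 : ℕ) + 1/2) :
    ∀ m : ℕ, 1 ≤ m → m ≤ 2 * r - 2 →
      ∃ μ : Fin r → ℝ, isRootBr μ ∧
        ip (((ℓ : ℝ) + m) • ω₁ + ρ) μ = (ℓ : ℝ) + 2 * r - 1 ∧
        (((ℓ : ℝ) + m) • ω₁ + ρ) ∈
          {lam : Fin r → ℝ | ip lam μ = 1 * ((ℓ : ℝ) + (2 * r - 1))} := by
  intro m hm1 hm2
  suffices h : ∃ μ : Fin r → ℝ, isRootBr μ ∧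
      ip (((ℓ : ℝ) + m) • ω₁ + ρ) μ = (ℓ : ℝ) + 2 * r - 1 by
    obtain ⟨μ, hμ, h⟩ := h
    refine ⟨μ, hμ, h, ?_⟩
    rw [Set.mem_ofPred_eq, h]
    ring
  subst hω hρ
  rcases Nat.lt_or_ge m r with hmr | hmr
  · refine ⟨stdE r ⟨0, by omega⟩ + stdE r ⟨m, hmr⟩,
      Or.inl ⟨_, _, Fin.mk_lt_mk.mpr (by omega), Or.inl rfl⟩, ?_⟩
    have hm0 : m ≠ 0 := by omega
    rw [ip_add_right, ip_stdE, ip_stdE]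
    simp [stdE, hm0]
    ring
  · obtain ⟨k, hk⟩ : ∃ k, k + m + 1 = 2 * r := ⟨2 * r - 1 - m, by omega⟩
    have hk0 : k ≠ 0 := by omega
    refine ⟨stdE r ⟨0, by omega⟩ - stdE r ⟨k, by omega⟩,
      Or.inl ⟨_, _, Fin.mk_lt_mk.mpr (by omega), Or.inr (Or.inl rfl)⟩, ?_⟩
    have hk' : (k : ℝ) + m + 1 = 2 * r := by exact_mod_cast hk
    rw [ip_sub_right, ip_stdE, ip_stdE]
    simp [stdE, hk0]
    linarith
end

section
/- Let r ≥ 4 and ℓ ≥ 1 be integers. In ℝ^r with the standard inner product ⟨·,·⟩, with D_r data ω₁ = e₁ and ρ = Σ_{i=1}^r (r − i) e_i, the following holds: for every integer m with 1 ≤ m ≤ 2r−3 there exists a root μ of D_r (i.e. μ ∈ {±e_i ± e_j : i < j}) such that ⟨(ℓ+m)ω₁ + ρ, μ⟩ = ℓ + 2r − 2. That is, each of the vectors (ℓ+1)ω₁ + ρ, (ℓ+2)ω₁ + ρ, …, (ℓ+2r−3)ω₁ + ρ lies on an affine wall H_{μ,1} of D_r at level ℓ. -/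
open Finset

/-- `v` is a root of `D_r`: one of `±eᵢ ± eⱼ` (`i < j`). -/
def isRootDr {r : ℕ} (v : Fin r → ℝ) : Prop :=
  ∃ i j : Fin r, i < j ∧ (v = stdE r i + stdE r j ∨ v = stdE r i - stdE r j ∨
    v = -stdE r i + stdE r j ∨ v = -stdE r i - stdE r j)

/-- **(All D_r walls).**  With the `D_r` data `ω₁ = e₁` and `ρ = Σᵢ (r − i) eᵢ`,
for every `1 ≤ m ≤ 2r−3` there exists a root `μ` of `D_r` such that
`⟨(ℓ+m)ω₁ + ρ, μ⟩ = ℓ + 2r − 2`; i.e. each vector `(ℓ+m)ω₁ + ρ`, `1 ≤ m ≤ 2r−3 = ȟ−1`,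
lies on an affine wall `H_{μ,1}` of `D_r` at level `ℓ`. -/
theorem stmt_15 (r ℓ : ℕ) (hr : 4 ≤ r) (hℓ : 1 ≤ ℓ)
    (ω₁ : Fin r → ℝ) (hω : ω₁ = stdE r ⟨0, by omega⟩)
    (ρ : Fin r → ℝ) (hρ : ρ = fun i : Fin r => (r : ℝ) - ((i : ℕ) + 1 : ℕ)) :
    ∀ m : ℕ, 1 ≤ m → m ≤ 2 * r - 3 →
      ∃ μ : Fin r → ℝ, isRootDr μ ∧
        ip (((ℓ : ℝ) + m) • ω₁ + ρ) μ = (ℓ : ℝ) + 2 * r - 2 ∧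
        (((ℓ : ℝ) + m) • ω₁ + ρ) ∈
          {lam : Fin r → ℝ | ip lam μ = 1 * ((ℓ : ℝ) + (2 * r - 2))} := by
  intro m hm1 hm2
  subst hω hρ
  suffices h : ∃ μ : Fin r → ℝ, isRootDr μ ∧
      ip (((ℓ : ℝ) + m) • stdE r ⟨0, by omega⟩ +
        fun i : Fin r => (r : ℝ) - ((i : ℕ) + 1 : ℕ)) μ = (ℓ : ℝ) + 2 * r - 2 by
    obtain ⟨μ, hμ, h⟩ := h
    refine ⟨μ, hμ, h, ?_⟩
    rw [Set.mem_ofPred_eq, h]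
    ring
  rcases Nat.lt_or_ge m r with hmr | hmr
  · refine ⟨stdE r ⟨0, by omega⟩ + stdE r ⟨m, hmr⟩,
      ⟨_, _, Fin.mk_lt_mk.2 (by omega), Or.inl rfl⟩, ?_⟩
    have hm0 : m ≠ 0 := by omega
    simp only [ip_add_right, ip_stdE]
    simp [stdE, hm0]
    ring
  · obtain ⟨j, hj⟩ : ∃ j, j + m = 2 * r - 2 := ⟨2 * r - 2 - m, by omega⟩
    refine ⟨stdE r ⟨0, by omega⟩ - stdE r ⟨j, by omega⟩,
      ⟨_, _, Fin.mk_lt_mk.2 (by omega), Or.inr (Or.inl rfl)⟩, ?_⟩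
    have hj0 : j ≠ 0 := by omega
    have hjm : (j : ℝ) + m + 2 = 2 * r := by
      exact_mod_cast (by omega : j + m + 2 = 2 * r)
    simp only [ip_sub_right, ip_stdE]
    simp [stdE, hj0]
    linarith
end
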